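/- Let K be a field and L the free Lie algebra over K on distinct generators a₁, a₂. The set A₀ = {(α • ι(a₁), α • ι(a₂)) : α ∈ K} ⊆ L² equals the set of pairs (y₁, y₂) ∈ L² satisfying the equations ⁅y₁, ι(a₁)⁆ = 0, ⁅y₂, ι(a₂)⁆ = 0, and ⁅y₁, ι(a₂)⁆ = ⁅ι(a₁), y₂⁆. -/

import Mathlib

namespace FreeLieAlgebra

section Embedding

attribute [local instance] LieRing.ofAssociativeRing

variable {K : Type*} [Field K] {X : Type*}

theorem induction_on {motive : FreeLieAlgebra K X → Prop} (y : FreeLieAlgebra K X)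
    (zero : motive 0) (add : ∀ u v, motive u → motive v → motive (u + v))
    (smul : ∀ (c : K) u, motive u → motive (c • u)) (of : ∀ x, motive (of K x))
    (lie : ∀ u v, motive u → motive v → motive ⁅u, v⁆) : motive y := by
  let S : LieSubalgebra K (FreeLieAlgebra K X) :=
    { carrier := {u | motive u}
      zero_mem' := zero
      add_mem' := fun {u v} hu hv => add u v hu hv
      smul_mem' := fun c u hu => smul c u hu
      lie_mem' := fun {u v} hu hv => lie u v hu hv }
  let f : FreeLieAlgebra K X →ₗ⁅K⁆ S := lift K fun x => ⟨FreeLieAlgebra.of K x, of x⟩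
  have hf : S.incl.comp f = LieHom.id := by
    ext x
    simp [f]
  have hy : (f y : FreeLieAlgebra K X) = y := by
    simpa using LieHom.congr_fun hf y
  rw [← hy]
  exact (f y).2

/-- The canonical map from the free Lie algebra to the free associative algebra. -/
noncomputable def toFreeAlgebra (K X : Type*) [Field K] :
    FreeLieAlgebra K X →ₗ⁅K⁆ FreeAlgebra K X :=
  lift K (FreeAlgebra.ι K)

@[simp]
theorem toFreeAlgebra_of (x : X) : toFreeAlgebra K X (of K x) = FreeAlgebra.ι K x := by
  simp [toFreeAlgebra]

theorem lift_eq_freeAlgebra_lift {A : Type*} [Ring A] [Algebra K A] (f : X → A)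
    (y : FreeLieAlgebra K X) : lift K f y = FreeAlgebra.lift K f (toFreeAlgebra K X y) := by
  have h : lift K f = (FreeAlgebra.lift K f).toLieHom.comp (toFreeAlgebra K X) := by
    ext x
    simp
  rw [h]
  rfl

/-- `WeightLE w n y` says that `y` is a linear combination of iterated brackets of generators
whose total weight with respect to `w` is at most `n`. -/
inductive WeightLE (w : X → ℕ) : ℕ → FreeLieAlgebra K X → Prop
  | zero (n : ℕ) : WeightLE w n 0
  | add {n : ℕ} {u v : FreeLieAlgebra K X} :
      WeightLE w n u → WeightLE w n v → WeightLE w n (u + v)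
  | smul {n : ℕ} (c : K) {u : FreeLieAlgebra K X} : WeightLE w n u → WeightLE w n (c • u)
  | of {n : ℕ} (x : X) : w x ≤ n → WeightLE w n (of K x)
  | lie {i j n : ℕ} {u v : FreeLieAlgebra K X} :
      WeightLE w i u → WeightLE w j v → i + j ≤ n → WeightLE w n ⁅u, v⁆

theorem WeightLE.mono {w : X → ℕ} {m n : ℕ} {y : FreeLieAlgebra K X} (h : WeightLE w m y)
    (hmn : m ≤ n) : WeightLE w n y := by
  induction h generalizing n with
  | zero => exact .zero n
  | add _ _ hu hv => exact .add (hu hmn) (hv hmn)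
  | smul c _ hu => exact .smul c (hu hmn)
  | of x hx => exact .of x (hx.trans hmn)
  | lie hu hv hij => exact .lie hu hv (hij.trans hmn)

theorem WeightLE.eq_zero {w : X → ℕ} {n : ℕ} {y : FreeLieAlgebra K X} (h : WeightLE w n y)
    (hw : ∀ x, n < w x) : y = 0 := by
  induction h with
  | zero => rfl
  | add _ _ hu hv => simp [hu hw, hv hw]
  | smul c _ hu => simp [hu hw]
  | of x hx => exact absurd hx (hw x).not_ge
  | lie _ _ hij hu => simp [hu fun x => lt_of_le_of_lt (by lia) (hw x)]

theorem exists_weightLE (y : FreeLieAlgebra K X) :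
    ∃ (n : ℕ) (S : Set X), S.Finite ∧
      ∀ w : X → ℕ, (∀ x ∈ S, w x ≤ 1) → WeightLE w n y := by
  induction y using induction_on with
  | zero => exact ⟨0, ∅, Set.finite_empty, fun w _ => .zero 0⟩
  | add u v hu hv =>
    obtain ⟨m, S, hS, hu⟩ := hu
    obtain ⟨n, T, hT, hv⟩ := hv
    exact ⟨m + n, S ∪ T, hS.union hT, fun w hw =>
      .add ((hu w fun x hx => hw x (.inl hx)).mono (by lia))
        ((hv w fun x hx => hw x (.inr hx)).mono (by lia))⟩
  | smul c u hu =>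
    obtain ⟨m, S, hS, hu⟩ := hu
    exact ⟨m, S, hS, fun w hw => .smul c (hu w hw)⟩
  | of x => exact ⟨1, {x}, Set.finite_singleton x, fun w hw => .of x (hw x rfl)⟩
  | lie u v hu hv =>
    obtain ⟨m, S, hS, hu⟩ := hu
    obtain ⟨n, T, hT, hv⟩ := hv
    exact ⟨m + n, S ∪ T, hS.union hT, fun w hw =>
      .lie (hu w fun x hx => hw x (.inl hx)) (hv w fun x hx => hw x (.inr hx)) le_rfl⟩

/-- The generators obtained by eliminating `a`: the pair `(x, k)` stands for `(ad a)ᵏ x`. -/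
abbrev ElimIndex (a : X) : Type _ := {x : X // x ≠ a} × ℕ

/-- The map sending the generator `(x, k)` to `(ad a)ᵏ x`. -/
noncomputable def elim (K : Type*) [Field K] (a : X) :
    FreeLieAlgebra K (ElimIndex a) →ₗ⁅K⁆ FreeLieAlgebra K X :=
  lift K fun p => (fun z => ⁅of K a, z⁆)^[p.2] (of K p.1.1)

theorem elim_of (a : X) (p : ElimIndex a) :
    elim K a (of K p) = (fun z => ⁅of K a, z⁆)^[p.2] (of K p.1.1) := by
  simp [elim]

theorem elim_of_succ (a : X) (x : {x : X // x ≠ a}) (k : ℕ) :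
    elim K a (of K (x, k + 1)) = ⁅of K a, elim K a (of K (x, k))⁆ := by
  simp only [elim_of, Function.iterate_succ_apply']

/-- The weight on the generators `(ad a)ᵏ x` induced by a weight on the original generators. -/
def elimWeight (w : X → ℕ) (a : X) (p : ElimIndex a) : ℕ := w p.1.1 + p.2 * w a

theorem WeightLE.exists_lie_elim {w : X → ℕ} {a : X} {n : ℕ}
    {v : FreeLieAlgebra K (ElimIndex a)} (h : WeightLE (elimWeight w a) n v) :
    ∃ v', WeightLE (elimWeight w a) (n + w a) v' ∧ ⁅FreeLieAlgebra.of K a, elim K a v⁆ = elim K a v' := by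
  induction h with
  | zero n => exact ⟨0, .zero _, by simp⟩
  | add _ _ hu hv =>
    obtain ⟨u', hu', hu⟩ := hu
    obtain ⟨v', hv', hv⟩ := hv
    exact ⟨u' + v', .add hu' hv', by simp [hu, hv]⟩
  | smul c _ hu =>
    obtain ⟨u', hu', hu⟩ := hu
    exact ⟨c • u', .smul c hu', by simp [hu]⟩
  | of p hp =>
    refine ⟨FreeLieAlgebra.of K (p.1, p.2 + 1), .of _ ?_, (elim_of_succ a p.1 p.2).symm⟩
    simp only [elimWeight] at hp ⊢
    linarith
  | @lie i j n u v hwu hwv hij hu hv =>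
    obtain ⟨u', hu', hu⟩ := hu
    obtain ⟨v', hv', hv⟩ := hv
    refine ⟨⁅u', v⁆ + ⁅u, v'⁆, .add (.lie hu' hwv (by lia)) (.lie hwu hv' (by lia)), ?_⟩
    rw [LieHom.map_lie, leibniz_lie, hu, hv, map_add, LieHom.map_lie, LieHom.map_lie]

theorem WeightLE.exists_eq_smul_add_elim {w : X → ℕ} (a : X) {n : ℕ} {y : FreeLieAlgebra K X}
    (h : WeightLE w n y) :
    ∃ (c : K) (u : FreeLieAlgebra K (ElimIndex a)), (c = 0 ∨ w a ≤ n) ∧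
      WeightLE (elimWeight w a) n u ∧
        y = c • FreeLieAlgebra.of K a + elim K a u := by
  induction h with
  | zero n => exact ⟨0, 0, .inl rfl, .zero n, by simp⟩
  | add _ _ hu hv =>
    obtain ⟨c, u', hc, hu', rfl⟩ := hu
    obtain ⟨d, v', hd, hv', rfl⟩ := hv
    refine ⟨c + d, u' + v', ?_, .add hu' hv', ?_⟩
    · rcases hc with rfl | hc
      · simpa using hd
      · exact .inr hc
    · rw [add_smul, map_add]
      abel
  | smul r _ hu =>
    obtain ⟨c, u', hc, hu', rfl⟩ := hu
    refine ⟨r * c, r • u', hc.imp (by simp +contextual) id, .smul r hu', ?_⟩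
    rw [mul_smul, map_smul, smul_add]
  | @of n x hx =>
    by_cases hxa : x = a
    · subst hxa
      exact ⟨1, 0, .inr hx, .zero n, by simp⟩
    · refine ⟨0, FreeLieAlgebra.of K (⟨x, hxa⟩, 0), .inl rfl, .of _ (by simpa [elimWeight] using hx), ?_⟩
      simp [elim_of]
  | @lie i j n _ _ _ _ hij hu hv =>
    obtain ⟨c, u, hc, hu, rfl⟩ := hu
    obtain ⟨d, v, hd, hv, rfl⟩ := hv
    obtain ⟨u', hu', hau⟩ := hu.exists_lie_elim
    obtain ⟨v', hv', hav⟩ := hv.exists_lie_elim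
    refine ⟨0, c • v' + (-d) • u' + ⁅u, v⁆, .inl rfl,
      .add (.add ?_ ?_) (.lie hu hv hij), ?_⟩
    · rcases hc with rfl | hc
      · simpa using WeightLE.zero n
      · exact .smul c (hv'.mono (by lia))
    · rcases hd with rfl | hd
      · simpa using WeightLE.zero n
      · exact .smul (-d) (hu'.mono (by lia))
    · have hua : ⁅elim K a u, FreeLieAlgebra.of K a⁆ = - elim K a u' := by rw [← hau, lie_skew]
      simp [hav, hua]
      abel

/-- The derivation of the free associative algebra on the generators `(x, k)` that sends
`(x, k)` to `(x, k + 1)`. -/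
noncomputable def shift (K : Type*) [Field K] (a : X) :
    Module.End K (FreeAlgebra K (ElimIndex a)) :=
  (TrivSqZeroExt.sndHom (FreeAlgebra K (ElimIndex a)) (FreeAlgebra K (ElimIndex a))).restrictScalars
      K ∘ₗ
    (FreeAlgebra.lift K fun p : ElimIndex a =>
      (TrivSqZeroExt.inl (FreeAlgebra.ι K p) + TrivSqZeroExt.inr (FreeAlgebra.ι K (p.1, p.2 + 1)) :
        DualNumber (FreeAlgebra K (ElimIndex a)))).toLinearMap

theorem shift_one (a : X) : shift K a 1 = 0 := by
  simp [shift]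

theorem shift_ι_mul (a : X) (p : ElimIndex a) (t : FreeAlgebra K (ElimIndex a)) :
    shift K a (FreeAlgebra.ι K p * t) =
      FreeAlgebra.ι K p * shift K a t + FreeAlgebra.ι K (p.1, p.2 + 1) * t := by
  have h : (TrivSqZeroExt.fstHom K (FreeAlgebra K (ElimIndex a)) (FreeAlgebra K (ElimIndex a))).comp
      (FreeAlgebra.lift K fun p : ElimIndex a =>
        (TrivSqZeroExt.inl (FreeAlgebra.ι K p) +
          TrivSqZeroExt.inr (FreeAlgebra.ι K (p.1, p.2 + 1)) :
          DualNumber (FreeAlgebra K (ElimIndex a)))) = AlgHom.id K _ := by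
    ext p
    simp
  have ht := DFunLike.congr_fun h t
  simp only [AlgHom.comp_apply, TrivSqZeroExt.fstHom_apply, AlgHom.id_apply] at ht
  simp [shift, -DualNumber.inr_eq_smul_eps, ht]

open Classical in
/-- The representation of the free Lie algebra in which `a` acts by `shift` and every other
generator `x` acts by left multiplication by `(x, 0)`. -/
noncomputable def elimRep (K : Type*) [Field K] (a : X) :
    FreeLieAlgebra K X →ₗ⁅K⁆ Module.End K (FreeAlgebra K (ElimIndex a)) :=
  lift K fun x => if h : x = a then shift K a else
    LinearMap.mulLeft K (FreeAlgebra.ι K (⟨x, h⟩, 0))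

theorem elimRep_elim (a : X) (u : FreeLieAlgebra K (ElimIndex a)) :
    elimRep K a (elim K a u) = LinearMap.mulLeft K (toFreeAlgebra K _ u) := by
  have h : (elimRep K a).comp (elim K a) =
      (Algebra.lmul K (FreeAlgebra K (ElimIndex a))).toLieHom.comp (toFreeAlgebra K _) := by
    ext1 ⟨x, k⟩
    simp only [LieHom.comp_apply, toFreeAlgebra_of, AlgHom.coe_toLieHom]
    induction k with
    | zero =>
      ext1 t
      simp [elim_of, elimRep, x.2]
    | succ k ih =>
      rw [elim_of_succ, LieHom.map_lie, ih]
      ext1 t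
      simp [elimRep, LieRing.of_associative_ring_bracket, shift_ι_mul]
  exact LieHom.congr_fun h u

theorem toFreeAlgebra_eq_zero_of_smul_add_elim {a : X} {c : K}
    {u : FreeLieAlgebra K (ElimIndex a)}
    (h : toFreeAlgebra K X (c • of K a + elim K a u) = 0) : toFreeAlgebra K _ u = 0 := by
  have h₁ : elimRep K a (c • of K a + elim K a u) = 0 := by
    rw [elimRep, lift_eq_freeAlgebra_lift, h, map_zero]
  have h₂ := LinearMap.congr_fun h₁ 1
  rw [map_add, elimRep_elim, map_smul] at h₂
  simpa [elimRep, shift_one] using h₂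

theorem WeightLE.eq_zero_of_toFreeAlgebra_eq_zero.{u} {n : ℕ} (i : ℕ) :
    ∀ {X : Type u} {w : X → ℕ} {y : FreeLieAlgebra K X}, {x | w x ≤ n}.Finite →
      (∀ x, n + 1 ≤ w x + i) → (∀ x, 1 ≤ w x) → WeightLE w n y →
      toFreeAlgebra K X y = 0 → y = 0 := by
  induction i with
  | zero => exact fun _ hw _ hy _ => hy.eq_zero hw
  | succ i ih =>
    suffices H : ∀ (m : ℕ) {X : Type u} {w : X → ℕ} {y : FreeLieAlgebra K X},
        {x | w x ≤ n}.Finite → (∀ x, n + 1 ≤ w x + (i + 1)) → (∀ x, 1 ≤ w x) →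
        {x | w x + i = n}.ncard = m → WeightLE w n y → toFreeAlgebra K X y = 0 → y = 0 from
      fun {_ _ _} hfin hw hpos hy h0 => H _ hfin hw hpos rfl hy h0
    intro m
    induction m with
    | zero =>
      intro X w y hfin hw hpos hm hy h0
      have hfin' : {x | w x + i = n}.Finite := hfin.subset fun x (hx : w x + i = n) => by
        simp only [Set.mem_ofPred_eq]
        lia
      rw [Set.ncard_eq_zero hfin'] at hm
      refine ih hfin (fun x => ?_) hpos hy h0
      have hx : ¬ w x + i = n := fun hx => (Set.eq_empty_iff_forall_notMem.mp hm x) hx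
      have := hw x
      lia
    | succ m ihm =>
      intro X w y hfin hw hpos hm hy h0
      obtain ⟨a, ha⟩ : {x | w x + i = n}.Nonempty :=
        Set.nonempty_of_ncard_ne_zero (by lia)
      replace ha : w a + i = n := ha
      obtain ⟨c, u, -, hu, rfl⟩ := hy.exists_eq_smul_add_elim a
      have hmul : ∀ k : ℕ, k ≤ k * w a := fun k => Nat.le_mul_of_pos_right k (hpos a)
      have hu0 : u = 0 := by
        refine ihm (w := elimWeight w a) ?_ (fun p => ?_) (fun p => ?_) ?_ hu
          (toFreeAlgebra_eq_zero_of_smul_add_elim h0)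
        · refine ((hfin.preimage Subtype.val_injective.injOn).prod (Set.finite_Iic n)).subset ?_
          rintro ⟨x, k⟩ hx
          simp only [elimWeight, Set.mem_ofPred_eq] at hx
          have := hmul k
          exact ⟨show w x ≤ n by lia, show k ≤ n by lia⟩
        · have := hw p.1
          simp only [elimWeight]
          lia
        · have := hpos p.1
          simp only [elimWeight]
          lia
        · have himage : (fun p : ElimIndex a => p.1.1) '' {p | elimWeight w a p + i = n} =
              {x | w x + i = n} \ {a} := by
            ext x
            constructor
            · rintro ⟨⟨x, k⟩, hx, rfl⟩
              simp only [elimWeight, Set.mem_ofPred_eq] at hx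
              have := hw x
              exact ⟨show w x + i = n by lia, x.2⟩
            · rintro ⟨hx, hxa⟩
              exact ⟨(⟨x, hxa⟩, 0), by simpa [elimWeight] using hx, rfl⟩
          rw [← Set.InjOn.ncard_image (f := fun p : ElimIndex a => p.1.1), himage,
            Set.ncard_sdiff_singleton_of_mem (Set.mem_ofPred_eq ▸ ha), hm, Nat.add_sub_cancel]
          have hzero : ∀ p : ElimIndex a, elimWeight w a p + i = n → p.2 = 0 := by
            intro p hp
            have h₁ := hw p.1
            have h₂ := hmul p.2
            simp only [elimWeight] at hp
            lia
          intro p hp q hq hpq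
          exact Prod.ext (Subtype.ext hpq) ((hzero p hp).trans (hzero q hq).symm)
      subst hu0
      have hc : c = 0 := by simpa [FreeAlgebra.ι_ne_zero] using h0
      simp [hc]

theorem toFreeAlgebra_injective : Function.Injective (toFreeAlgebra K X) := by
  classical
  refine (injective_iff_map_eq_zero _).mpr fun y hy => ?_
  obtain ⟨n, S, hS, h⟩ := exists_weightLE y
  let w : X → ℕ := fun x => if x ∈ S then 1 else n + 1
  refine WeightLE.eq_zero_of_toFreeAlgebra_eq_zero (n := n) (w := w) n (hS.subset fun x hx => ?_)
    (fun x => ?_) (fun x => ?_) (h w fun x hx => by simp [w, hx]) hy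
  · by_contra hxS
    simp [w, hxS] at hx
  · simp only [w]
    split_ifs <;> lia
  · simp only [w]
    split_ifs <;> lia

/-- An element of the monoid algebra of words that commutes with a letter `a` has zero coefficient
at every word containing another letter. -/
theorem coeff_eq_zero_of_commute {a b : X} (hb : b ≠ a) {f : MonoidAlgebra K (FreeMonoid X)}
    (hf : Commute (MonoidAlgebra.single (FreeMonoid.of a) 1) f) (r : List X) (k : ℕ) :
    f.coeff (FreeMonoid.ofList (List.replicate k a ++ b :: r)) = 0 := by
  have hleft : ∀ v : FreeMonoid X, f.coeff v =
      (f * MonoidAlgebra.single (FreeMonoid.of a) 1).coeff (FreeMonoid.of a * v) := by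
    intro v
    rw [← hf.eq, MonoidAlgebra.coeff_single_mul_eq_mul_coeff v (by simp), one_mul]
  have hcons : ∀ (k : ℕ) (s : List X), FreeMonoid.of a *
      FreeMonoid.ofList (List.replicate k a ++ s) =
        FreeMonoid.ofList (List.replicate (k + 1) a ++ s) := fun _ _ => rfl
  have hlast : ∀ {c : X}, c ≠ a → ∀ s : List X,
      (f * MonoidAlgebra.single (FreeMonoid.of a) 1).coeff (FreeMonoid.ofList (s ++ [c])) = 0 := by
    intro c hc s
    refine MonoidAlgebra.coeff_mul_single_of_forall_mul_ne _ _ fun d hd => hc ?_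
    have h : d.toList ++ [a] = s ++ [c] := hd
    simpa using (List.append_inj' h rfl).2.symm
  induction r using List.reverseRecOn generalizing k with
  | nil =>
    rw [hleft, hcons]
    exact hlast hb _
  | append_singleton r c ih =>
    have hassoc : List.replicate (k + 1) a ++ b :: (r ++ [c]) =
      (List.replicate (k + 1) a ++ b :: r) ++ [c] := by simp
    rw [hleft, hcons, hassoc]
    by_cases hc : c = a
    · subst hc
      rw [FreeMonoid.ofList_append, FreeMonoid.ofList_singleton,
        MonoidAlgebra.coeff_mul_single_eq_coeff_mul
          (FreeMonoid.ofList (List.replicate (k + 1) c ++ b :: r)) (by simp), ih, zero_mul]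
    · exact hlast hc _

theorem exists_eq_replicate_append_cons {a : X} (l : List X)
    (hl : ∃ b ∈ l, b ≠ a) : ∃ (k : ℕ) (b : X) (r : List X), b ≠ a ∧
      l = List.replicate k a ++ b :: r := by
  induction l with
  | nil => simp at hl
  | cons x l ih =>
    by_cases hx : x = a
    · subst hx
      obtain ⟨k, b, r, hb, rfl⟩ := ih (by simpa using hl)
      exact ⟨k + 1, b, r, hb, by simp [List.replicate_succ]⟩
    · exact ⟨0, x, l, hx, rfl⟩

open Classical in
/-- The endomorphism of the monoid algebra of words that fixes the letter `a` and kills every other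
letter. -/
noncomputable def restrictLetter (K : Type*) [Field K] (a : X) :
    MonoidAlgebra K (FreeMonoid X) →ₐ[K] MonoidAlgebra K (FreeMonoid X) :=
  MonoidAlgebra.lift K _ _ (FreeMonoid.lift fun x =>
    if x = a then MonoidAlgebra.single (FreeMonoid.of a) 1 else 0)

theorem restrictLetter_single_of (a x : X) :
    restrictLetter K a (MonoidAlgebra.single (FreeMonoid.of x) 1) =
      open Classical in if x = a then MonoidAlgebra.single (FreeMonoid.of a) 1 else 0 := by
  simp [restrictLetter]

theorem restrictLetter_single_of_forall_eq {a : X} (l : List X) (hl : ∀ x ∈ l, x = a) (c : K) :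
    restrictLetter K a (MonoidAlgebra.single (FreeMonoid.ofList l) c) =
      MonoidAlgebra.single (FreeMonoid.ofList l) c := by
  induction l with
  | nil => simp [restrictLetter, MonoidAlgebra.one_def]
  | cons x l ih =>
    have hx : MonoidAlgebra.single (FreeMonoid.ofList (x :: l)) c =
        MonoidAlgebra.single (FreeMonoid.of x) 1 *
          MonoidAlgebra.single (FreeMonoid.ofList l) c := by
      rw [MonoidAlgebra.single_mul_single, one_mul, FreeMonoid.ofList_cons]
    rw [hx, map_mul, ih fun z hz => hl z (by simp [hz]), restrictLetter_single_of, hl x (by simp),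
      if_pos rfl]

theorem restrictLetter_eq_self_of_commute {a : X} {f : MonoidAlgebra K (FreeMonoid X)}
    (hf : Commute (MonoidAlgebra.single (FreeMonoid.of a) 1) f) : restrictLetter K a f = f := by
  have hsum := MonoidAlgebra.sum_coeff_single f
  rw [← hsum, Finsupp.sum, map_sum]
  refine Finset.sum_congr rfl fun v hv => ?_
  refine restrictLetter_single_of_forall_eq v.toList (fun x hx => ?_) _
  by_contra hxa
  obtain ⟨k, b, r, hb, hv'⟩ := exists_eq_replicate_append_cons v.toList ⟨x, hx, hxa⟩
  refine Finsupp.mem_support_iff.mp hv ?_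
  rw [← FreeMonoid.ofList_toList v, hv']
  exact coeff_eq_zero_of_commute hb hf r k

theorem exists_restrictLetter_eq_smul (a : X) (y : FreeLieAlgebra K X) : ∃ c : K,
    restrictLetter K a (FreeAlgebra.equivMonoidAlgebraFreeMonoid (toFreeAlgebra K X y)) =
      c • MonoidAlgebra.single (FreeMonoid.of a) 1 := by
  induction y using induction_on with
  | zero => exact ⟨0, by simp⟩
  | add u v hu hv =>
    obtain ⟨c, hc⟩ := hu
    obtain ⟨d, hd⟩ := hv
    exact ⟨c + d, by rw [map_add, map_add, map_add, hc, hd, add_smul]⟩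
  | smul r u hu =>
    obtain ⟨c, hc⟩ := hu
    exact ⟨r * c, by rw [map_smul, map_smul, map_smul, hc, mul_smul]⟩
  | of x =>
    have hx : FreeAlgebra.equivMonoidAlgebraFreeMonoid (FreeAlgebra.ι K x) =
        MonoidAlgebra.single (FreeMonoid.of x) 1 := by
      simp [FreeAlgebra.equivMonoidAlgebraFreeMonoid]
    rw [toFreeAlgebra_of, hx, restrictLetter_single_of]
    split_ifs
    · exact ⟨1, (one_smul _ _).symm⟩
    · exact ⟨0, (zero_smul _ _).symm⟩
  | lie u v hu hv =>
    obtain ⟨c, hc⟩ := hu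
    obtain ⟨d, hd⟩ := hv
    refine ⟨0, ?_⟩
    rw [LieHom.map_lie, LieRing.of_associative_ring_bracket, map_sub, map_sub, map_mul, map_mul,
      map_mul, map_mul, hc, hd, smul_mul_smul_comm, smul_mul_smul_comm, mul_comm c d, sub_self,
      zero_smul]

/-- The centralizer of a generator of a free Lie algebra is the line it spans. -/
theorem exists_eq_smul_of_lie_of_eq_zero {a : X} {y : FreeLieAlgebra K X}
    (h : ⁅y, of K a⁆ = 0) : ∃ c : K, y = c • of K a := by
  have ha : FreeAlgebra.equivMonoidAlgebraFreeMonoid (FreeAlgebra.ι K a) =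
      MonoidAlgebra.single (FreeMonoid.of a) 1 := by
    simp [FreeAlgebra.equivMonoidAlgebraFreeMonoid]
  have hcomm : Commute (FreeAlgebra.ι K a) (toFreeAlgebra K X y) := by
    have h₁ := congrArg (toFreeAlgebra K X) h
    rw [LieHom.map_lie, map_zero, toFreeAlgebra_of, LieRing.of_associative_ring_bracket,
      sub_eq_zero] at h₁
    exact h₁.symm
  have hcomm' := hcomm.map (FreeAlgebra.equivMonoidAlgebraFreeMonoid (R := K) (X := X))
  rw [ha] at hcomm'
  obtain ⟨c, hc⟩ := exists_restrictLetter_eq_smul a y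
  rw [restrictLetter_eq_self_of_commute hcomm', ← ha, ← map_smul] at hc
  refine ⟨c, toFreeAlgebra_injective ?_⟩
  rw [FreeAlgebra.equivMonoidAlgebraFreeMonoid.injective hc, map_smul, toFreeAlgebra_of]

theorem lie_of_of_ne_zero {a b : X} (hab : a ≠ b) : ⁅of K a, of K b⁆ ≠ 0 := by
  classical
  intro h
  obtain ⟨c, hc⟩ := exists_eq_smul_of_lie_of_eq_zero h
  have := congrArg (lift K fun x => if x = a then (1 : K) else 0) hc
  simp [hab.symm] at this

end Embedding

end FreeLieAlgebra

theorem scalar_diagonal_e_definable {K : Type*} [Field K] {X : Type*} (a₁ a₂ : X)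
    (ha : a₁ ≠ a₂) :
    {p : FreeLieAlgebra K X × FreeLieAlgebra K X |
        ∃ α : K, p = (α • FreeLieAlgebra.of K a₁, α • FreeLieAlgebra.of K a₂)} =
      {p : FreeLieAlgebra K X × FreeLieAlgebra K X |
        ⁅p.1, FreeLieAlgebra.of K a₁⁆ = 0 ∧ ⁅p.2, FreeLieAlgebra.of K a₂⁆ = 0 ∧
          ⁅p.1, FreeLieAlgebra.of K a₂⁆ = ⁅FreeLieAlgebra.of K a₁, p.2⁆} := by
  ext ⟨y₁, y₂⟩
  simp only [Set.mem_ofPred_eq, Prod.mk.injEq]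
  constructor
  · rintro ⟨α, rfl, rfl⟩
    simp
  · rintro ⟨h₁, h₂, h⟩
    obtain ⟨α, rfl⟩ := FreeLieAlgebra.exists_eq_smul_of_lie_of_eq_zero h₁
    obtain ⟨β, rfl⟩ := FreeLieAlgebra.exists_eq_smul_of_lie_of_eq_zero h₂
    rw [smul_lie, lie_smul] at h
    obtain rfl := smul_left_injective K (FreeLieAlgebra.lie_of_of_ne_zero ha) h
    exact ⟨α, rfl, rfl⟩
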